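/- arXiv:1411.3218 — 3 statements merged into one kernel-verified Lean document; each statement's English description precedes it below -/
import Mathlib

section
/- Let B be a unital C*-algebra, q ∈ ℂ with q ≠ 0, and set ζ = q/(conj q). Suppose (α₁, γ₁) and (α₂, γ₂) are pairs of elements of B that ζ-commute. Define α̃ = α₁α₂ − q·γ₁*γ₂ and γ̃ = γ₁α₂ + α₁*γ₂. Then in M₂(B) one has the matrix identity [[α₁, -q·γ₁*], [γ₁, α₁*]] · [[α₂, -q·γ₂*], [γ₂, α₂*]] = [[α̃, -q·γ̃*], [γ̃, α̃*]]. -/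
/-- Two pairs `(α₁, γ₁)` and `(α₂, γ₂)` of elements of an algebra `ζ`-commute. -/
def ZetaCommute {A : Type*} [Ring A] [StarRing A] [Algebra ℂ A]
    (ζ : ℂ) (α₁ γ₁ α₂ γ₂ : A) : Prop :=
  Commute α₁ α₂ ∧ Commute α₁ (star α₂) ∧ Commute α₁ γ₂ ∧ Commute α₁ (star γ₂) ∧
  Commute γ₁ α₂ ∧ Commute γ₁ (star α₂) ∧
  γ₁ * γ₂ = ζ • (γ₂ * γ₁) ∧
  γ₁ * star γ₂ = (starRingEnd ℂ ζ) • (star γ₂ * γ₁)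

/-- The product of the two fundamental matrices of `ζ`-commuting `SU_q(2)`-type pairs is
again a matrix of the same form, built from `α̃ = α₁α₂ − q γ₁* γ₂` and
`γ̃ = γ₁α₂ + α₁* γ₂`. -/
theorem su2q_matrix_mul {B : Type*} [NormedRing B] [StarRing B] [CStarRing B]
    [NormedAlgebra ℂ B] [StarModule ℂ B] [CompleteSpace B]
    (q : ℂ) (hq : q ≠ 0) (ζ : ℂ) (hζ : ζ = q / starRingEnd ℂ q)
    (α₁ γ₁ α₂ γ₂ : B) (hcomm : ZetaCommute ζ α₁ γ₁ α₂ γ₂) :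
    !![α₁, -(q • star γ₁); γ₁, star α₁] * !![α₂, -(q • star γ₂); γ₂, star α₂] =
      !![α₁ * α₂ - q • (star γ₁ * γ₂), -(q • star (γ₁ * α₂ + star α₁ * γ₂));
         γ₁ * α₂ + star α₁ * γ₂, star (α₁ * α₂ - q • (star γ₁ * γ₂))] := by
  obtain ⟨hα, -, -, hαγ, hγα, -, -, hγ⟩ := hcomm
  have hα' : star α₁ * star α₂ = star α₂ * star α₁ := hα.star_star.eq
  have hγα' : star γ₁ * star α₂ = star α₂ * star γ₁ := hγα.star_star.eq
  have hqζ : q * starRingEnd ℂ ζ = starRingEnd ℂ q := by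
    rw [hζ, map_div₀, Complex.conj_conj, mul_div_cancel₀ _ hq]
  have h₀₁ : α₁ * -(q • star γ₂) + -(q • star γ₁) * star α₂ =
      -(q • star (γ₁ * α₂ + star α₁ * γ₂)) := by
    simp only [star_add, star_mul, star_star, mul_neg, neg_mul, mul_smul_comm,
      smul_mul_assoc, smul_add, neg_add, hαγ.eq, hγα']
    abel
  have h₁₁ : γ₁ * -(q • star γ₂) + star α₁ * star α₂ =
      star (α₁ * α₂ - q • (star γ₁ * γ₂)) := by
    rw [star_sub, star_smul, star_mul, star_mul, star_star, hα', mul_neg, mul_smul_comm,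
      hγ, smul_smul, hqζ, starRingEnd_apply, neg_add_eq_sub]
  rw [Matrix.mul_fin_two, h₀₁, h₁₁, neg_mul, smul_mul_assoc, ← sub_eq_add_neg]
end

section
/- Let B be a unital C*-algebra, q ∈ ℂ with q ≠ 0, and set ζ = q/(conj q). Suppose (α₁, γ₁), (α₂, γ₂), (α₃, γ₃) are pairs of elements of B such that (αᵢ, γᵢ) and (αⱼ, γⱼ) ζ-commute for every i < j. For two pairs p = (α, γ) and p' = (α', γ') define m(p, p') = (αα' − q·γ*γ', γα' + α*γ'). Then m(m((α₁,γ₁),(α₂,γ₂)),(α₃,γ₃)) = m((α₁,γ₁), m((α₂,γ₂),(α₃,γ₃))), i.e. both the α-components and the γ-components of the two iterated combinations coincide. -/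
/-- The combination of two pairs of generators given by the comultiplication of `SU_q(2)`:
`m((α,γ),(α',γ')) = (αα' − q γ* γ', γα' + α* γ')`. -/
def mPair {A : Type*} [Ring A] [StarRing A] [Algebra ℂ A]
    (q : ℂ) (p p' : A × A) : A × A :=
  (p.1 * p'.1 - q • (star p.2 * p'.2), p.2 * p'.1 + star p.1 * p'.2)

/-- Coassociativity of the comultiplication of `SU_q(2)` on the level of generators. -/
theorem su2q_comultiplication_coassociative {B : Type*} [NormedRing B] [StarRing B]
    [CStarRing B] [NormedAlgebra ℂ B] [StarModule ℂ B] [CompleteSpace B]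
    (q : ℂ) (hq : q ≠ 0) (ζ : ℂ) (hζ : ζ = q / starRingEnd ℂ q)
    (α₁ γ₁ α₂ γ₂ α₃ γ₃ : B)
    (h₁₂ : ZetaCommute ζ α₁ γ₁ α₂ γ₂)
    (h₁₃ : ZetaCommute ζ α₁ γ₁ α₃ γ₃)
    (h₂₃ : ZetaCommute ζ α₂ γ₂ α₃ γ₃) :
    mPair q (mPair q (α₁, γ₁) (α₂, γ₂)) (α₃, γ₃) =
      mPair q (α₁, γ₁) (mPair q (α₂, γ₂) (α₃, γ₃)) := by
  obtain ⟨hα, -, -, hαγ, hγα, -, -, hγγ⟩ := h₁₂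
  have hα_star : star α₂ * star α₁ = star α₁ * star α₂ := by
    rw [← star_mul, ← star_mul, hα.eq]
  have hγα_star : star α₂ * star γ₁ = star γ₁ * star α₂ := by
    rw [← star_mul, ← star_mul, hγα.eq]
  have hqζ : q * starRingEnd ℂ ζ = starRingEnd ℂ q := by
    rw [hζ, map_div₀, Complex.conj_conj, mul_div_cancel₀ _ hq]
  have hqγ : q • (γ₁ * star γ₂) = starRingEnd ℂ q • (star γ₂ * γ₁) := by
    rw [hγγ, smul_smul, hqζ]
  refine Prod.ext ?_ ?_
  · simp only [mPair, star_add, star_mul, star_star, sub_mul, add_mul, mul_sub, mul_add,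
      smul_add, smul_mul_assoc, mul_smul_comm, hγα_star, ← hαγ.eq, mul_assoc]
    abel
  · have hγ : q • (γ₁ * (star γ₂ * γ₃)) = starRingEnd ℂ q • (star γ₂ * (γ₁ * γ₃)) := by
      rw [← mul_assoc, ← smul_mul_assoc, hqγ, smul_mul_assoc, mul_assoc]
    have hα₃ : star α₂ * (star α₁ * γ₃) = star α₁ * (star α₂ * γ₃) := by
      rw [← mul_assoc, hα_star, mul_assoc]
    simp only [mPair, star_sub, star_smul, star_mul, star_star, sub_mul, add_mul, mul_sub,
      mul_add, smul_mul_assoc, mul_smul_comm, mul_assoc, hγ, hα₃, starRingEnd_apply]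
    abel
end

section
/- Let A be a unital C*-algebra, q ∈ ℂ, and α, γ ∈ A with γ normal (γγ* = γ*γ), satisfying αγ = (conj q)·γα and αγ* = q·γ*α. Then for every continuous function f : ℂ → ℂ one has α · f(γ) = f̃(γ) · α, where f(γ) denotes the continuous functional calculus of f applied to the normal element γ, and f̃ : ℂ → ℂ is the continuous function f̃(λ) = f((conj q)·λ). -/
/-- Two continuous star homomorphisms out of `C(s, ℂ)` whose values at the coordinate function and
at its conjugate are intertwined by `x` are intertwined by `x` everywhere. -/
theorem ContinuousMap.semiconjBy_starAlgHom {A : Type*} [CStarAlgebra A] {s : Set ℂ}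
    [CompactSpace s] {φ ψ : C(s, ℂ) →⋆ₐ[ℂ] A} (hφ : Continuous φ) (hψ : Continuous ψ) {x : A}
    (h : SemiconjBy x (φ (.restrict s (.id ℂ))) (ψ (.restrict s (.id ℂ))))
    (hstar : SemiconjBy x (star (φ (.restrict s (.id ℂ)))) (star (ψ (.restrict s (.id ℂ)))))
    (f : C(s, ℂ)) : SemiconjBy x (φ f) (ψ f) := by
  induction f using ContinuousMap.induction_on_of_compact with
  | const r =>
    have hr : ContinuousMap.const s r = algebraMap ℂ C(s, ℂ) r := rfl
    rw [hr, AlgHomClass.commutes, AlgHomClass.commutes]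
    exact Algebra.commute_algebraMap_right r x
  | id => exact h
  | star_id => rwa [map_star, map_star]
  | add f g hf hg => rw [map_add, map_add]; exact hf.add_right hg
  | mul f g hf hg => rw [map_mul, map_mul]; exact hf.mul_right hg
  | frequently f hf =>
    have hclosed : IsClosed {g : C(s, ℂ) | x * φ g = ψ g * x} :=
      isClosed_eq (by fun_prop) (by fun_prop)
    exact hclosed.closure_subset (mem_closure_iff_frequently.mpr hf)

/-- If `x` intertwines the normal elements `a` and `b`, and also their adjoints, then it
intertwines `cfc f a` and `cfc f b`. -/
theorem SemiconjBy.cfc {A : Type*} [CStarAlgebra A] {a b x : A} (ha : IsStarNormal a)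
    (hb : IsStarNormal b) (h : SemiconjBy x a b) (hstar : SemiconjBy x (star a) (star b))
    {f : ℂ → ℂ} (hf : ContinuousOn f (spectrum ℂ a ∪ spectrum ℂ b)) :
    SemiconjBy x (cfc f a) (cfc f b) := by
  let s : Set ℂ := spectrum ℂ a ∪ spectrum ℂ b
  have : CompactSpace s :=
    isCompact_iff_compactSpace.mp ((spectrum.isCompact a).union (spectrum.isCompact b))
  let i : C(spectrum ℂ a, s) := ⟨Set.inclusion Set.subset_union_left, continuous_inclusion _⟩
  let j : C(spectrum ℂ b, s) := ⟨Set.inclusion Set.subset_union_right, continuous_inclusion _⟩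
  let φ : C(s, ℂ) →⋆ₐ[ℂ] A := (cfcHom ha).comp (i.compStarAlgHom' ℂ ℂ)
  let ψ : C(s, ℂ) →⋆ₐ[ℂ] A := (cfcHom hb).comp (j.compStarAlgHom' ℂ ℂ)
  have hφ : Continuous φ := (cfcHom_continuous ha).comp i.continuous_precomp
  have hψ : Continuous ψ := (cfcHom_continuous hb).comp j.continuous_precomp
  have hφ_id : φ (.restrict s (.id ℂ)) = a := cfcHom_id ha
  have hψ_id : ψ (.restrict s (.id ℂ)) = b := cfcHom_id hb
  have key := ContinuousMap.semiconjBy_starAlgHom hφ hψ (by rwa [hφ_id, hψ_id])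
    (by rwa [hφ_id, hψ_id]) ⟨s.domRestrict f, hf.domRestrict⟩
  rw [cfc_apply f a ha (hf.mono Set.subset_union_left),
    cfc_apply f b hb (hf.mono Set.subset_union_right)]
  exact key

/-- If `γ` is normal and `α γ = q̄ γ α`, `α γ* = q γ* α`, then `α f(γ) = f̃(γ) α` for every
continuous function `f`, where `f̃(λ) = f(q̄ λ)`. -/
theorem su2q_cfc_commutation {A : Type*} [CStarAlgebra A]
    (q : ℂ) (α γ : A) (hγ : IsStarNormal γ)
    (h1 : α * γ = (starRingEnd ℂ q) • (γ * α))
    (h2 : α * star γ = q • (star γ * α))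
    (f : ℂ → ℂ) (hf : Continuous f) :
    α * cfc f γ = cfc (fun lam => f ((starRingEnd ℂ q) * lam)) γ * α := by
  rw [cfc_comp_const_mul (starRingEnd ℂ q) f γ hf.continuousOn hγ]
  have hb : IsStarNormal (starRingEnd ℂ q • γ) := inferInstance
  refine (SemiconjBy.cfc hγ hb ?_ ?_ hf.continuousOn).eq
  · rw [SemiconjBy, h1, smul_mul_assoc]
  · rw [SemiconjBy, h2, star_smul, starRingEnd_apply, star_star, smul_mul_assoc]
end
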